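/- arXiv:2512.16733 — 2 statements merged into one kernel-verified Lean document; each statement's English description precedes it below -/
import Mathlib

section
/- (Theorem 2) Let D ⊆ D* be datasets such that for every abstract state s and every capability c there exists a state s' with (s, c, s') ∈ D*. Then there exists a finite set T of transitions disjoint from D (namely T = D* \ D) such that the pessimistic and optimistic models built from the updated dataset D ∪ T are equivalent. -/
/-- The effect of a transition from `s` to `s'`: atoms added and atoms deleted. -/
def eta {Atom : Type*} [DecidableEq Atom] (s s' : Finset Atom) :
    Finset Atom × Finset Atom :=
  (s' \ s, s \ s')

/-- Applying an effect pair `(A, B)` to a state `s` gives `(s \ B) ∪ A`. -/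
def applyEff {Atom : Type*} [DecidableEq Atom] (s : Finset Atom)
    (e : Finset Atom × Finset Atom) : Finset Atom :=
  (s \ e.2) ∪ e.1

/-- The set of effects observed for capability `c` from state `s` in dataset `D`. -/
def etaSet {Atom C : Type*} [DecidableEq Atom] [DecidableEq C] (c : C) (s : Finset Atom)
    (D : Finset (Finset Atom × C × Finset Atom)) : Finset (Finset Atom × Finset Atom) :=
  (D.filter (fun t => t.1 = s ∧ t.2.1 = c)).image (fun t => eta t.1 t.2.2)

/-- A state `s` is observed for `c` in `D` iff some effect was observed. -/
def observedFor {Atom C : Type*} [DecidableEq Atom] [DecidableEq C] (c : C) (s : Finset Atom)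
    (D : Finset (Finset Atom × C × Finset Atom)) : Prop :=
  (etaSet c s D).Nonempty

/-- The pessimistic model built from `D` entails the transition `(s, c, s')`. -/
def pessEntails {Atom C : Type*} [DecidableEq Atom] [DecidableEq C]
    (D : Finset (Finset Atom × C × Finset Atom))
    (s : Finset Atom) (c : C) (s' : Finset Atom) : Prop :=
  ∃ e ∈ etaSet c s D, applyEff s e = s'

/-- The optimistic model built from `D` entails the transition `(s, c, s')`. -/
def optEntails {Atom C : Type*} [DecidableEq Atom] [DecidableEq C]
    (D : Finset (Finset Atom × C × Finset Atom))
    (s : Finset Atom) (c : C) (s' : Finset Atom) : Prop :=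
  ∃ s0 : Finset Atom, observedFor c s0 D ∧
    (etaSet c s D = ∅ ∨ etaSet c s D = etaSet c s0 D) ∧
    ∃ e ∈ etaSet c s0 D, applyEff s e = s'

theorem observedFor_of_mem {Atom C : Type*} [DecidableEq Atom] [DecidableEq C]
    {D : Finset (Finset Atom × C × Finset Atom)} {s s' : Finset Atom} {c : C}
    (h : (s, c, s') ∈ D) : observedFor c s D :=
  ⟨eta s s', Finset.mem_image.2 ⟨(s, c, s'), Finset.mem_filter.2 ⟨h, rfl, rfl⟩, rfl⟩⟩

/-- At an observed state the pessimistic and optimistic models entail the same transitions. -/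
theorem pessEntails_iff_optEntails_of_observedFor {Atom C : Type*} [DecidableEq Atom]
    [DecidableEq C] {D : Finset (Finset Atom × C × Finset Atom)} {s : Finset Atom} {c : C}
    (h : observedFor c s D) (s' : Finset Atom) :
    pessEntails D s c s' ↔ optEntails D s c s' := by
  constructor
  · exact fun hp => ⟨s, h, Or.inr rfl, hp⟩
  · rintro ⟨s0, -, hempty | heq, e, he, hs'⟩
    · exact absurd hempty h.ne_empty
    · exact ⟨e, heq ▸ he, hs'⟩

/-- Theorem 2: if `D ⊆ D*` and `D*` contains a transition from every state for every
capability, then there is a finite set `T` of transitions disjoint from `D`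
(namely `T = D* \ D`) such that the pessimistic and optimistic models built from the
updated dataset `D ∪ T` are equivalent. -/
theorem finite_update_makes_models_equiv {Atom C : Type*} [Fintype Atom] [DecidableEq Atom]
    [Fintype C] [DecidableEq C]
    (D Dstar : Finset (Finset Atom × C × Finset Atom))
    (hsub : D ⊆ Dstar)
    (hfull : ∀ (s : Finset Atom) (c : C), ∃ s' : Finset Atom, (s, c, s') ∈ Dstar) :
    ∃ T : Finset (Finset Atom × C × Finset Atom),
      Disjoint T D ∧ T = Dstar \ D ∧
      (∀ (s : Finset Atom) (c : C) (s' : Finset Atom),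
        pessEntails (D ∪ T) s c s' ↔ optEntails (D ∪ T) s c s') := by
  refine ⟨Dstar \ D, Finset.sdiff_disjoint, rfl, fun s c s' => ?_⟩
  rw [Finset.union_sdiff_of_subset hsub]
  exact pessEntails_iff_optEntails_of_observedFor (observedFor_of_mem (hfull s c).choose_spec) s'
end

section
/- (Theorem 3) Let D ⊆ D* be datasets such that: (i) for every abstract state s and every capability c there exists s' with (s, c, s') ∈ D*; (ii) every capability c has at least one state observed for c in D; and (iii) for every state s and capability c, if s is observed for c in D then every transition (s, c, s') ∈ D* also lies in D. If the pessimistic and optimistic models built from D are equivalent, then both models entail exactly the transitions of D*: for every transition t, the pessimistic model built from D entails t if and only if t ∈ D*. -/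
theorem applyEff_eta {Atom : Type*} [DecidableEq Atom] (s s' : Finset Atom) :
    applyEff s (eta s s') = s' := by
  ext a
  simp only [applyEff, eta, Finset.mem_union, Finset.mem_sdiff]
  tauto

theorem mem_etaSet {Atom C : Type*} [DecidableEq Atom] [DecidableEq C] {c : C}
    {s : Finset Atom} {D : Finset (Finset Atom × C × Finset Atom)}
    {e : Finset Atom × Finset Atom} :
    e ∈ etaSet c s D ↔ ∃ s', (s, c, s') ∈ D ∧ eta s s' = e := by
  simp only [etaSet, Finset.mem_image, Finset.mem_filter]
  constructor
  · rintro ⟨⟨_, _, s'⟩, ⟨h, rfl, rfl⟩, rfl⟩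
    exact ⟨s', h, rfl⟩
  · rintro ⟨s', h, rfl⟩
    exact ⟨(s, c, s'), ⟨h, rfl, rfl⟩, rfl⟩

/-- The pessimistic model entails exactly the transitions of its dataset. -/
theorem pessEntails_iff_mem {Atom C : Type*} [DecidableEq Atom] [DecidableEq C]
    {D : Finset (Finset Atom × C × Finset Atom)} {s : Finset Atom} {c : C}
    {s' : Finset Atom} : pessEntails D s c s' ↔ (s, c, s') ∈ D := by
  constructor
  · rintro ⟨e, he, rfl⟩
    obtain ⟨s', h, rfl⟩ := mem_etaSet.1 he
    rwa [applyEff_eta]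
  · exact fun h => ⟨eta s s', mem_etaSet.2 ⟨s', h, rfl⟩, applyEff_eta s s'⟩

/-- If some state is observed for `c` and the two models are equivalent, then every state is
observed for `c`. -/
theorem observedFor_of_equiv {Atom C : Type*} [DecidableEq Atom] [DecidableEq C]
    {D : Finset (Finset Atom × C × Finset Atom)} {c : C}
    (hobs : ∃ s : Finset Atom, observedFor c s D)
    (hequiv : ∀ s s' : Finset Atom, pessEntails D s c s' ↔ optEntails D s c s')
    (s : Finset Atom) : observedFor c s D := by
  by_contra h
  obtain ⟨s0, h0⟩ := hobs
  obtain ⟨e, he⟩ := id h0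
  obtain ⟨e', he', -⟩ := (hequiv s (applyEff s e)).2
    ⟨s0, h0, Or.inl (Finset.not_nonempty_iff_eq_empty.1 h), e, he, rfl⟩
  exact h ⟨e', he'⟩

/-- Theorem 3: under assumptions (i)–(iii), if the pessimistic and optimistic models
built from `D` are equivalent, then both models entail exactly the transitions of
`D*`. -/
theorem equiv_models_entail_true_model {Atom C : Type*} [Fintype Atom] [DecidableEq Atom]
    [Fintype C] [DecidableEq C]
    (D Dstar : Finset (Finset Atom × C × Finset Atom))
    (hsub : D ⊆ Dstar)
    (hfull : ∀ (s : Finset Atom) (c : C), ∃ s' : Finset Atom, (s, c, s') ∈ Dstar)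
    (hobs : ∀ c : C, ∃ s : Finset Atom, observedFor c s D)
    (heff : ∀ (s : Finset Atom) (c : C), observedFor c s D →
      ∀ s' : Finset Atom, (s, c, s') ∈ Dstar → (s, c, s') ∈ D)
    (hequiv : ∀ (s : Finset Atom) (c : C) (s' : Finset Atom),
      pessEntails D s c s' ↔ optEntails D s c s') :
    (∀ (s : Finset Atom) (c : C) (s' : Finset Atom),
        pessEntails D s c s' ↔ (s, c, s') ∈ Dstar) ∧
    (∀ (s : Finset Atom) (c : C) (s' : Finset Atom),
        optEntails D s c s' ↔ (s, c, s') ∈ Dstar) := by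
  have hpess (s : Finset Atom) (c : C) (s' : Finset Atom) :
      pessEntails D s c s' ↔ (s, c, s') ∈ Dstar :=
    pessEntails_iff_mem.trans
      ⟨fun h => hsub h,
        heff s c (observedFor_of_equiv (hobs c) (fun s s' => hequiv s c s') s) s'⟩
  exact ⟨hpess, fun s c s' => (hequiv s c s').symm.trans (hpess s c s')⟩
end
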